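/- Let n ≥ 2 and k ≥ 1, and work in the braid group Br_{nk}. For 1 ≤ t ≤ n−1 set δ_t := σ_t·σ_{n+t}·σ_{2n+t}⋯σ_{(k−1)n+t}, and let H be the subgroup of Br_{nk} generated by all band generators σ_{i,j} with 1 ≤ i < j ≤ nk and i ≡ j (mod n). Then for every t with 1 ≤ t ≤ n−1 the subgroup H is invariant under conjugation by δ_t, i.e. δ_t·H·δ_t^{−1} = H. -/

import Mathlib

open Polynomial

noncomputable section

/-- Defining relations of the Artin braid group on `m` strands: the generators are
indexed by `Fin (m - 1)`, with index `i` corresponding to `σ_{i+1}`; the relations are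
`σ_i σ_j = σ_j σ_i` for `|i - j| ≥ 2` and `σ_i σ_{i+1} σ_i = σ_{i+1} σ_i σ_{i+1}`. -/
def braidRels (m : ℕ) : Set (FreeGroup (Fin (m - 1))) :=
  { r | (∃ i j : Fin (m - 1), (i : ℕ) + 2 ≤ (j : ℕ) ∧
          r = .of i * .of j * (.of i)⁻¹ * (.of j)⁻¹) ∨
        (∃ i j : Fin (m - 1), (j : ℕ) = (i : ℕ) + 1 ∧
          r = .of i * .of j * .of i * (.of j * .of i * .of j)⁻¹) }

/-- The Artin braid group on `m` strands. -/
def BraidGroup (m : ℕ) : Type := PresentedGroup (braidRels m)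

instance (m : ℕ) : Group (BraidGroup m) :=
  inferInstanceAs (Group (PresentedGroup (braidRels m)))

/-- The Artin generator `σ_i` of the braid group on `m` strands, for `1 ≤ i ≤ m - 1`
(junk value `1` for invalid indices). -/
def σg (m : ℕ) (i : ℕ) : BraidGroup m :=
  if h : 0 < i ∧ i < m then PresentedGroup.of ⟨i - 1, by omega⟩ else 1

/-- The band generator `σ_{i,j} = (σ_{j-1} σ_{j-2} ⋯ σ_{i+1}) σ_i (σ_{j-1} σ_{j-2} ⋯ σ_{i+1})⁻¹`
of the braid group on `m` strands; in particular `σ_{i,i+1} = σ_i`. -/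
def band (m i j : ℕ) : BraidGroup m :=
  (((List.range' (i + 1) (j - i - 1)).reverse.map (σg m)).prod) * σg m i *
    (((List.range' (i + 1) (j - i - 1)).reverse.map (σg m)).prod)⁻¹

theorem σg_comm {m i j : ℕ} (h : i + 2 ≤ j) : Commute (σg m i) (σg m j) := by
  by_cases hij : 0 < i ∧ j < m
  · obtain ⟨hi, hj⟩ := hij
    have hr : PresentedGroup.mk (braidRels m) _ = 1 := PresentedGroup.one_of_mem
      (Or.inl ⟨⟨i - 1, by omega⟩, ⟨j - 1, by omega⟩, by simp only; omega, rfl⟩)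
    simp only [map_mul, map_inv] at hr
    have hr' := mul_inv_eq_iff_eq_mul.mp (mul_inv_eq_one.mp hr)
    have hσi : σg m i = _ := dif_pos (show 0 < i ∧ i < m by omega)
    have hσj : σg m j = _ := dif_pos (show 0 < j ∧ j < m by omega)
    rw [hσi, hσj]
    exact hr'
  · rcases not_and_or.mp hij with hi | hj
    · have hσ : σg m i = 1 := dif_neg (by omega)
      exact hσ ▸ Commute.one_left _
    · have hσ : σg m j = 1 := dif_neg (by omega)
      exact hσ ▸ Commute.one_right _

theorem σg_braid {m i : ℕ} (hi : 1 ≤ i) (h : i + 1 < m) :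
    σg m i * σg m (i + 1) * σg m i = σg m (i + 1) * σg m i * σg m (i + 1) := by
  have hr : PresentedGroup.mk (braidRels m) _ = 1 := PresentedGroup.one_of_mem
    (Or.inr ⟨⟨i - 1, by omega⟩, ⟨i + 1 - 1, by omega⟩, by simp only; omega, rfl⟩)
  simp only [map_mul, map_inv] at hr
  have hr' := mul_inv_eq_one.mp hr
  have hσ : σg m i = _ := dif_pos (show 0 < i ∧ i < m by omega)
  have hσ' : σg m (i + 1) = _ := dif_pos (show 0 < i + 1 ∧ i + 1 < m by omega)
  rw [hσ, hσ']
  exact hr'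

section Group

variable {G : Type*} [Group G] {a b c : G}

theorem braid_conj (g : G) (h : a * b * a = b * a * b) :
    (g * a * g⁻¹) * (g * b * g⁻¹) * (g * a * g⁻¹) =
      (g * b * g⁻¹) * (g * a * g⁻¹) * (g * b * g⁻¹) := by
  simpa only [map_mul, MulAut.conj_apply] using congrArg (MulAut.conj g) h

/-- The two expressions `(σ₂σ₁σ₃)²` and `(σ₁σ₃σ₂)²` of the Garside element on four strands. -/
theorem half_twist_eq (hac : a * c * a = c * a * c) (hbc : b * c * b = c * b * c)
    (hab : a * b = b * a) : c * (a * b) * c * (a * b) = a * b * c * (a * b) * c :=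
  calc c * (a * b) * c * (a * b)
    _ = c * (a * b) * c * (b * a) := by rw [hab]
    _ = c * a * (b * c * b) * a := by group
    _ = (c * a * c) * b * c * a := by rw [hbc]; group
    _ = a * c * (a * b) * c * a := by rw [← hac]; group
    _ = a * c * b * (a * c * a) := by rw [hab]; group
    _ = a * (c * b * c) * a * c := by rw [hac]; group
    _ = a * b * c * (b * a) * c := by rw [← hbc]; group
    _ = a * b * c * (a * b) * c := by rw [hab]

theorem conj_eq_of_mul_mul_comm {d : G} (h : c * d * c * d = d * c * d * c) :
    d * c * d⁻¹ = c⁻¹ * (d⁻¹ * c * d) * c := by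
  rw [mul_inv_eq_iff_eq_mul]
  calc d * c = c⁻¹ * d⁻¹ * (d * c * d * c) := by group
    _ = c⁻¹ * (d⁻¹ * c * d) * c * d := by rw [← h]; group

theorem conj_mul_eq_of_braid (hac : a * c * a = c * a * c) (hbc : b * c * b = c * b * c)
    (hab : a * b = b * a) :
    (a * b) * (b * c * b⁻¹) * (a * b)⁻¹ =
      (b * c * b⁻¹)⁻¹ * (a⁻¹ * c * a) * (b * c * b⁻¹) := by
  have h := conj_eq_of_mul_mul_comm (half_twist_eq hac hbc hab)
  have hb : a * b * b = b * (a * b) := by rw [hab, mul_assoc, hab]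
  calc (a * b) * (b * c * b⁻¹) * (a * b)⁻¹ = (a * b * b) * c * (a * b * b)⁻¹ := by group
    _ = b * ((a * b) * c * (a * b)⁻¹) * b⁻¹ := by rw [hb]; group
    _ = _ := by rw [h]; group

end Group

section Band

variable {m i j p : ℕ}

theorem band_self_succ : band m i (i + 1) = σg m i := by
  simp [band]

theorem band_succ (h : i < j) :
    band m i (j + 1) = σg m j * band m i j * (σg m j)⁻¹ := by
  have hj : j + 1 - i - 1 = (j - i - 1) + 1 := by omega
  have hj' : i + 1 + (j - i - 1) = j := by omega
  simp only [band, hj, List.range'_1_concat, hj', List.reverse_append, List.reverse_singleton,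
    List.singleton_append, List.map_cons, List.prod_cons]
  group

theorem σg_commute_band_of_gt (hij : i < j) (h : j < p) :
    Commute (σg m p) (band m i j) := by
  induction j, hij using Nat.le_induction with
  | base => rw [band_self_succ]; exact (σg_comm (by omega)).symm
  | succ j hj ih =>
    rw [band_succ hj]
    have hc : Commute (σg m p) (σg m j) := (σg_comm (by omega)).symm
    exact (hc.mul_right (ih (by omega))).mul_right hc.inv_right

theorem σg_commute_band_of_lt (hij : i < j) (h : p + 1 < i) :
    Commute (σg m p) (band m i j) := by
  induction j, hij using Nat.le_induction with
  | base => rw [band_self_succ]; exact σg_comm (by omega)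
  | succ j hj ih =>
    rw [band_succ hj]
    have hc : Commute (σg m p) (σg m j) := σg_comm (by omega)
    exact (hc.mul_right ih).mul_right hc.inv_right

theorem σg_commute_band_of_between (hip : i < p) (hpj : p + 1 < j) (hj : j ≤ m) :
    Commute (σg m p) (band m i j) := by
  induction j, hpj using Nat.le_induction with
  | base =>
    rw [band_succ (by omega), band_succ hip]
    have hb := σg_braid (m := m) (i := p) (by omega) (by omega)
    have hc : Commute (σg m (p + 1)) (band m i p) := σg_commute_band_of_gt hip (by omega)
    have h1 : σg m p = (σg m (p + 1) * σg m p) * σg m (p + 1) * (σg m (p + 1) * σg m p)⁻¹ := by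
      rw [← hb]; group
    have h2 := hc.map (MulAut.conj (σg m (p + 1) * σg m p))
    simp only [MulAut.conj_apply] at h2
    rw [← h1] at h2
    convert h2 using 1
    group
  | succ j hj' ih =>
    rw [band_succ (by omega)]
    have hc : Commute (σg m p) (σg m j) := σg_comm (by omega)
    exact (hc.mul_right (ih (by omega))).mul_right hc.inv_right

theorem σg_commute_band (hij : i < j) (hj : j ≤ m)
    (h₁ : p ≠ i) (h₂ : p ≠ j) (h₃ : p + 1 ≠ i) (h₄ : p + 1 ≠ j) :
    Commute (σg m p) (band m i j) := by
  rcases lt_or_gt_of_ne h₂ with h | h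
  · rcases lt_or_gt_of_ne h₁ with h' | h'
    · exact σg_commute_band_of_lt hij (by omega)
    · exact σg_commute_band_of_between h' (by omega) hj
  · exact σg_commute_band_of_gt hij h

theorem σg_mul_band (hi : 1 ≤ i) (hij : i + 1 < j) (hj : j ≤ m) :
    σg m i * band m i j = band m (i + 1) j * σg m i := by
  induction j, hij using Nat.le_induction with
  | base =>
    rw [band_succ (by omega), band_self_succ, band_self_succ, ← mul_assoc, ← mul_assoc,
      σg_braid hi (by omega)]
    group
  | succ j hj' ih =>
    rw [band_succ (by omega), band_succ (by omega)]
    have hc : Commute (σg m i) (σg m j) := σg_comm (by omega)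
    calc _ = σg m i * σg m j * band m i j * (σg m j)⁻¹ := by group
      _ = σg m j * (σg m i * band m i j) * (σg m j)⁻¹ := by rw [hc.eq]; group
      _ = σg m j * band m (i + 1) j * (σg m i * (σg m j)⁻¹) := by rw [ih (by omega)]; group
      _ = _ := by rw [hc.inv_right.eq]; group

theorem band_braid_right (hi : 1 ≤ i) (hij : i < j) (hj : j < m) :
    σg m j * band m i j * σg m j = band m i j * σg m j * band m i j := by
  induction j, hij using Nat.le_induction with
  | base => rw [band_self_succ, σg_braid hi hj]
  | succ j hj' ih =>
    have hb := σg_braid (m := m) (i := j) (by omega) hj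
    have hc : Commute (σg m (j + 1)) (band m i j) := σg_commute_band_of_gt hj' (by omega)
    have h := braid_conj (σg m j * σg m (j + 1)) (ih (by omega))
    have h₁ : σg m j * σg m (j + 1) * σg m j * (σg m j * σg m (j + 1))⁻¹ = σg m (j + 1) := by
      rw [hb]; group
    have h₂ : σg m j * σg m (j + 1) * band m i j * (σg m j * σg m (j + 1))⁻¹ =
        band m i (j + 1) := by
      rw [band_succ hj', mul_assoc (σg m j), hc.eq]; group
    rwa [h₁, h₂] at h

theorem band_braid_left (hi : 1 ≤ i) (hij : i + 1 < j) (hj : j ≤ m) :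
    σg m i * band m (i + 1) j * σg m i =
      band m (i + 1) j * σg m i * band m (i + 1) j := by
  induction j, hij using Nat.le_induction with
  | base => rw [band_self_succ, σg_braid hi (by omega)]
  | succ j hj' ih =>
    have hc : Commute (σg m i) (σg m j) := σg_comm (by omega)
    have h := braid_conj (σg m j) (ih (by omega))
    rwa [← hc.eq, mul_inv_cancel_right, ← band_succ (by omega)] at h

theorem band_eq_conj_left (hi : 1 ≤ i) (hij : i + 1 < j) (hj : j ≤ m) :
    band m i j = (σg m i)⁻¹ * band m (i + 1) j * σg m i := by
  rw [mul_assoc, ← σg_mul_band hi hij hj, inv_mul_cancel_left]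

theorem conj_band (hi : 1 ≤ i) (hij : i + 1 < j) (hj : j < m) :
    (σg m i * σg m j) * band m i j * (σg m i * σg m j)⁻¹ = band m (i + 1) (j + 1) := by
  have hc : Commute (σg m i) (σg m j) := σg_comm (by omega)
  rw [hc.eq, mul_assoc (σg m j), σg_mul_band hi hij hj.le, band_succ hij]
  group

theorem conj_band_succ (hi : 1 ≤ i) (hij : i + 1 < j) (hj : j < m) :
    (σg m i * σg m j) * band m (i + 1) (j + 1) * (σg m i * σg m j)⁻¹ =
      (band m (i + 1) (j + 1))⁻¹ * band m i j * band m (i + 1) (j + 1) := by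
  rw [band_succ hij, band_eq_conj_left hi hij hj.le]
  exact conj_mul_eq_of_braid (band_braid_left hi hij hj.le)
    (band_braid_right (by omega) hij hj) (σg_comm (by omega)).eq

end Band

/-- The element `δ_t` of the braid group on `n * k` strands. -/
def deltaElem (n k t : ℕ) : BraidGroup (n * k) :=
  ((List.range k).map fun c => σg (n * k) (c * n + t)).prod

theorem σg_commute_of_lt {m n t c d : ℕ} (hn : 2 ≤ n) (h : c < d) :
    Commute (σg m (c * n + t)) (σg m (d * n + t)) := by
  have : (c + 1) * n ≤ d * n := Nat.mul_le_mul_right n h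
  exact σg_comm (by linarith)

theorem deltaElem_eq_mul {n k t c d : ℕ} (hn : 2 ≤ n) (hcd : c < d) (hd : d < k) :
    ∃ l : List ℕ, c ∉ l ∧ d ∉ l ∧ deltaElem n k t =
      σg (n * k) (c * n + t) * σg (n * k) (d * n + t) *
        (l.map fun e => σg (n * k) (e * n + t)).prod := by
  have hdm : d ∈ (List.range k).erase c :=
    (List.mem_erase_of_ne hcd.ne').mpr (List.mem_range.mpr hd)
  have hperm : (List.range k).Perm (c :: d :: ((List.range k).erase c).erase d) :=
    (List.perm_cons_erase (List.mem_range.mpr (hcd.trans hd))).trans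
      ((List.perm_cons_erase hdm).cons c)
  have hnd := hperm.nodup_iff.mp List.nodup_range
  simp only [List.nodup_cons, List.mem_cons, not_or] at hnd
  refine ⟨_, hnd.1.2, hnd.2.1, ?_⟩
  rw [deltaElem, (hperm.map _).prod_eq', List.map_cons, List.map_cons, List.prod_cons,
    List.prod_cons, mul_assoc]
  rw [List.pairwise_map]
  exact List.pairwise_lt_range.imp fun h => σg_commute_of_lt hn h

theorem deltaElem_conj {n k t c d : ℕ} (hn : 2 ≤ n) (ht : 1 ≤ t) (ht' : t < n)
    (hcd : c < d) (hd : d < k) :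
    deltaElem n k t * band (n * k) (c * n + t) (d * n + t) * (deltaElem n k t)⁻¹ =
        band (n * k) (c * n + t + 1) (d * n + t + 1) ∧
      deltaElem n k t * band (n * k) (c * n + t + 1) (d * n + t + 1) * (deltaElem n k t)⁻¹ =
        (band (n * k) (c * n + t + 1) (d * n + t + 1))⁻¹ * band (n * k) (c * n + t) (d * n + t) *
          band (n * k) (c * n + t + 1) (d * n + t + 1) := by
  obtain ⟨l, hc, hd', hl⟩ := deltaElem_eq_mul (t := t) hn hcd hd
  have h₁ : (c + 1) * n ≤ d * n := Nat.mul_le_mul_right n hcd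
  have h₂ : (d + 1) * n ≤ k * n := Nat.mul_le_mul_right n hd
  have h₃ : n * k = k * n := mul_comm n k
  rw [add_mul, one_mul] at h₁ h₂
  have hne : ∀ {e f : ℕ}, e ≠ f → e * n + t ≠ f * n + t ∧ e * n + t ≠ f * n + t + 1 ∧
      e * n + t + 1 ≠ f * n + t := by
    intro e f hef
    rcases lt_or_gt_of_ne hef with h | h
    · have : (e + 1) * n ≤ f * n := Nat.mul_le_mul_right n h
      rw [add_mul] at this
      omega
    · have : (f + 1) * n ≤ e * n := Nat.mul_le_mul_right n h
      rw [add_mul] at this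
      omega
  set R := (l.map fun e => σg (n * k) (e * n + t)).prod
  have key : ∀ g : BraidGroup (n * k),
      (∀ e ∈ l, Commute (σg (n * k) (e * n + t)) g) →
      deltaElem n k t * g * (deltaElem n k t)⁻¹ =
        σg (n * k) (c * n + t) * σg (n * k) (d * n + t) * g *
          (σg (n * k) (c * n + t) * σg (n * k) (d * n + t))⁻¹ := by
    intro g hg
    have hR : Commute R g := by
      refine Commute.list_prod_left _ _ fun x hx => ?_
      obtain ⟨e, he, rfl⟩ := List.mem_map.mp hx
      exact hg e he
    rw [hl, mul_assoc _ R g, hR.eq]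
    group
  have hmem : ∀ e ∈ l, e ≠ c ∧ e ≠ d := fun e he =>
    ⟨fun h => hc (h ▸ he), fun h => hd' (h ▸ he)⟩
  constructor
  · rw [key _ fun e he => ?_]
    · exact conj_band (by omega) (by omega) (by omega)
    · have := hne (hmem e he).1
      have := hne (hmem e he).2
      exact σg_commute_band (by omega) (by omega) (by omega) (by omega) (by omega) (by omega)
  · rw [key _ fun e he => ?_]
    · exact conj_band_succ (by omega) (by omega) (by omega)
    · have := hne (hmem e he).1
      have := hne (hmem e he).2
      exact σg_commute_band (by omega) (by omega) (by omega) (by omega) (by omega) (by omega)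

theorem deltaElem_commute_band {n k t i j : ℕ} (hij : i < j) (hj : j ≤ n * k)
    (hmod : i % n = j % n) (h₁ : i % n ≠ t % n) (h₂ : i % n ≠ (t + 1) % n) :
    Commute (deltaElem n k t) (band (n * k) i j) := by
  refine Commute.list_prod_left _ _ fun x hx => ?_
  obtain ⟨e, -, rfl⟩ := List.mem_map.mp hx
  have ht : (e * n + t) % n = t % n := Nat.mul_add_mod_self_right ..
  have ht' : (e * n + t + 1) % n = (t + 1) % n := by rw [add_assoc, Nat.mul_add_mod_self_right]
  refine σg_commute_band hij hj ?_ ?_ ?_ ?_ <;> rintro rfl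
  exacts [h₁ ht, h₁ (hmod.trans ht), h₂ ht', h₂ (hmod.trans ht')]

theorem exists_eq_mul_add_of_mod_eq {n s i j : ℕ} (hij : i < j)
    (hi : i % n = s) (hj : j % n = s) : ∃ c d, c < d ∧ i = c * n + s ∧ j = d * n + s := by
  have hi' := Nat.div_add_mod' i n
  have hj' := Nat.div_add_mod' j n
  rw [hi] at hi'
  rw [hj] at hj'
  exact ⟨i / n, j / n, lt_of_mul_lt_mul_right (by omega) (Nat.zero_le n), hi'.symm, hj'.symm⟩

theorem band_pair_cases {n k t i j : ℕ} (ht : 1 ≤ t) (ht' : t < n) (hi : 1 ≤ i) (hij : i < j)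
    (hj : j ≤ n * k) (hmod : i % n = j % n) :
    (i % n ≠ t % n ∧ i % n ≠ (t + 1) % n) ∨
      ∃ c d, c < d ∧ d < k ∧ ((i = c * n + t ∧ j = d * n + t) ∨
        (i = c * n + t + 1 ∧ j = d * n + t + 1)) := by
  by_cases h₁ : i % n = t % n
  · right
    rw [Nat.mod_eq_of_lt ht'] at h₁
    obtain ⟨c, d, hcd, hc, hd⟩ := exists_eq_mul_add_of_mod_eq hij h₁ (hmod ▸ h₁)
    refine ⟨c, d, hcd, ?_, Or.inl ⟨hc, hd⟩⟩
    refine lt_of_mul_lt_mul_right (a := n) ?_ (Nat.zero_le n)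
    rw [mul_comm k]
    omega
  by_cases h₂ : i % n = (t + 1) % n
  · right
    have hm : (i - 1) % n = t := by
      have := (Nat.ModEq.add_right_cancel' 1 (show (i - 1) + 1 ≡ t + 1 [MOD n] by
        rw [Nat.sub_add_cancel hi]; exact h₂))
      rw [Nat.ModEq, Nat.mod_eq_of_lt ht'] at this
      exact this
    have hm' : (j - 1) % n = t := by
      have := (Nat.ModEq.add_right_cancel' 1 (show (j - 1) + 1 ≡ t + 1 [MOD n] by
        rw [Nat.sub_add_cancel (by omega)]; exact hmod.symm.trans h₂))
      rw [Nat.ModEq, Nat.mod_eq_of_lt ht'] at this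
      exact this
    obtain ⟨c, d, hcd, hc, hd⟩ := exists_eq_mul_add_of_mod_eq (by omega) hm hm'
    refine ⟨c, d, hcd, ?_, Or.inr ⟨by omega, by omega⟩⟩
    refine lt_of_mul_lt_mul_right (a := n) ?_ (Nat.zero_le n)
    rw [mul_comm k]
    omega
  exact Or.inl ⟨h₁, h₂⟩

/-- Let `n ≥ 2`, `k ≥ 1`, and for `1 ≤ t ≤ n - 1` let
`δ_t = σ_t σ_{n+t} σ_{2n+t} ⋯ σ_{(k-1)n+t} ∈ Br_{nk}`. The subgroup `H` of `Br_{nk}`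
generated by the band generators `σ_{i,j}` with `i ≡ j (mod n)` is invariant under
conjugation by `δ_t`. -/
theorem band_subgroup_conj_invariant (n k : ℕ) (hn : 2 ≤ n) (hk : 1 ≤ k)
    (t : ℕ) (ht : 1 ≤ t) (ht' : t ≤ n - 1) :
    Subgroup.map
        (MulAut.conj (((List.range k).map fun c => σg (n * k) (c * n + t)).prod)).toMonoidHom
        (Subgroup.closure
          { b : BraidGroup (n * k) | ∃ i j : ℕ, 1 ≤ i ∧ i < j ∧ j ≤ n * k ∧
              i % n = j % n ∧ b = band (n * k) i j }) =
      Subgroup.closure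
        { b : BraidGroup (n * k) | ∃ i j : ℕ, 1 ≤ i ∧ i < j ∧ j ≤ n * k ∧
            i % n = j % n ∧ b = band (n * k) i j } := by
  have ht'' : t < n := by omega
  change Subgroup.map (MulAut.conj (deltaElem n k t)).toMonoidHom _ = _
  set S := { b : BraidGroup (n * k) | ∃ i j : ℕ, 1 ≤ i ∧ i < j ∧ j ≤ n * k ∧
    i % n = j % n ∧ b = band (n * k) i j } with hS
  have hx : ∀ {c d}, c < d → d < k → band (n * k) (c * n + t) (d * n + t) ∈ S := by
    intro c d hcd hd
    have h₁ : (c + 1) * n ≤ d * n := Nat.mul_le_mul_right n hcd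
    have h₂ : (d + 1) * n ≤ k * n := Nat.mul_le_mul_right n hd
    rw [add_mul] at h₁ h₂
    have h₃ : n * k = k * n := mul_comm n k
    exact ⟨_, _, by omega, by omega, by omega, by simp, rfl⟩
  have hy : ∀ {c d}, c < d → d < k → band (n * k) (c * n + t + 1) (d * n + t + 1) ∈ S := by
    intro c d hcd hd
    have h₁ : (c + 1) * n ≤ d * n := Nat.mul_le_mul_right n hcd
    have h₂ : (d + 1) * n ≤ k * n := Nat.mul_le_mul_right n hd
    rw [add_mul] at h₁ h₂
    have h₃ : n * k = k * n := mul_comm n k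
    exact ⟨_, _, by omega, by omega, by omega, by simp [add_assoc], rfl⟩
  apply le_antisymm
  · rw [Subgroup.map_le_iff_le_comap, Subgroup.closure_le]
    rintro _ ⟨i, j, hi, hij, hj, hmod, rfl⟩
    change deltaElem n k t * band (n * k) i j * (deltaElem n k t)⁻¹ ∈ Subgroup.closure S
    rcases band_pair_cases ht ht'' hi hij hj hmod with
      ⟨h₁, h₂⟩ | ⟨c, d, hcd, hd, ⟨rfl, rfl⟩ | ⟨rfl, rfl⟩⟩
    · rw [(deltaElem_commute_band hij hj hmod h₁ h₂).eq, mul_inv_cancel_right]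
      exact Subgroup.subset_closure ⟨i, j, hi, hij, hj, hmod, rfl⟩
    · rw [(deltaElem_conj hn ht ht'' hcd hd).1]
      exact Subgroup.subset_closure (hy hcd hd)
    · rw [(deltaElem_conj hn ht ht'' hcd hd).2]
      have hy' := Subgroup.subset_closure (hy hcd hd)
      exact mul_mem (mul_mem (inv_mem hy') (Subgroup.subset_closure (hx hcd hd))) hy'
  · rw [Subgroup.closure_le]
    rintro _ ⟨i, j, hi, hij, hj, hmod, rfl⟩
    have hmap : ∀ {g}, g ∈ S → deltaElem n k t * g * (deltaElem n k t)⁻¹ ∈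
        Subgroup.map (MulAut.conj (deltaElem n k t)).toMonoidHom (Subgroup.closure S) :=
      fun hg => Subgroup.mem_map_of_mem (MulAut.conj (deltaElem n k t)).toMonoidHom
        (Subgroup.subset_closure hg)
    rcases band_pair_cases ht ht'' hi hij hj hmod with
      ⟨h₁, h₂⟩ | ⟨c, d, hcd, hd, ⟨rfl, rfl⟩ | ⟨rfl, rfl⟩⟩
    · have h := hmap ⟨i, j, hi, hij, hj, hmod, rfl⟩
      rwa [(deltaElem_commute_band hij hj hmod h₁ h₂).eq, mul_inv_cancel_right] at h
    · have h₁ := hmap (hx hcd hd)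
      have h₂ := hmap (hy hcd hd)
      rw [(deltaElem_conj hn ht ht'' hcd hd).1] at h₁
      rw [(deltaElem_conj hn ht ht'' hcd hd).2] at h₂
      have h := mul_mem (mul_mem h₁ h₂) (inv_mem h₁)
      rwa [← mul_assoc, mul_inv_cancel_right, mul_inv_cancel_left] at h
    · have h := hmap (hx hcd hd)
      rwa [(deltaElem_conj hn ht ht'' hcd hd).1] at h

end
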